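/- arXiv:1508.00005 — 2 statements merged into one kernel-verified Lean document; each statement's English description precedes it below -/
import Mathlib

section
/- Let V be a finite-dimensional complex vector space, A, B invertible linear endomorphisms of V with ABA = BAB, and let k ∈ ℂ be nonzero and m ∈ ℂ. Then the following are equivalent: (a) there exist S₁, S₂ with S₁² = S₂² = I, S₁S₂S₁ = S₂S₁S₂, S₁S₂A = BS₁S₂, ABS₁ = S₂AB, S₁S₂ = k·AB and Tr(S₁S₂) = m; (b) (AB)³ = k⁻³·I, Tr(AB) = k⁻¹·m, and m is an integer. -/
theorem aux_idem {V : Type*} [AddCommGroup V] [Module ℂ V] [FiniteDimensional ℂ V]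
    (P : Module.End ℂ V) (h : P * P = P) :
    LinearMap.trace ℂ V P = (Module.finrank ℂ (LinearMap.range P) : ℂ) := by
  have h2 : LinearMap.IsProj (LinearMap.range P) P := by
    refine ⟨fun x => ⟨x, rfl⟩, ?_⟩
    rintro _ ⟨y, rfl⟩
    exact LinearMap.congr_fun h y
  exact h2.trace

theorem aux_swap {V : Type*} [AddCommGroup V] [Module ℂ V] [FiniteDimensional ℂ V]
    (P Q : Module.End ℂ V) (hP : P * P = P) (hQ : Q * Q = Q)
    (h : Module.finrank ℂ (LinearMap.range P) = Module.finrank ℂ (LinearMap.range Q)) :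
    ∃ T U : Module.End ℂ V, T * P = T ∧ Q * T = T ∧ U * Q = U ∧ P * U = U ∧
      U * T = P ∧ T * U = Q := by
  let e := LinearEquiv.ofFinrankEq _ _ h
  have hP' : ∀ x : LinearMap.range P, P x = x := by
    rintro ⟨_, y, rfl⟩
    exact LinearMap.congr_fun hP y
  have hQ' : ∀ x : LinearMap.range Q, Q x = x := by
    rintro ⟨_, y, rfl⟩
    exact LinearMap.congr_fun hQ y
  have hP2 : ∀ x : LinearMap.range P, P.rangeRestrict x = x := fun x => Subtype.ext (hP' x)
  have hQ2 : ∀ x : LinearMap.range Q, Q.rangeRestrict x = x := fun x => Subtype.ext (hQ' x)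
  have hP3 : ∀ x, P.rangeRestrict (P x) = P.rangeRestrict x := fun x => hP2 (P.rangeRestrict x)
  have hQ3 : ∀ x, Q.rangeRestrict (Q x) = Q.rangeRestrict x := fun x => hQ2 (Q.rangeRestrict x)
  refine ⟨(LinearMap.range Q).subtype ∘ₗ e.toLinearMap ∘ₗ P.rangeRestrict,
    (LinearMap.range P).subtype ∘ₗ e.symm.toLinearMap ∘ₗ Q.rangeRestrict, ?_, ?_, ?_, ?_, ?_, ?_⟩ <;>
  · ext x
    simp [hP', hQ', hP2, hQ2, hP3, hQ3]

set_option maxHeartbeats 4000000 in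
theorem aux_proj {V : Type*} [AddCommGroup V] [Module ℂ V]
    (S : Module.End ℂ V) (hS : S * S * S = 1) (w : ℂ) (hw : w * w = -1 - w) :
    ∃ P Q R : Module.End ℂ V, P * P = P ∧ Q * Q = Q ∧ R * R = R ∧
      P * Q = 0 ∧ P * R = 0 ∧ Q * P = 0 ∧ Q * R = 0 ∧ R * P = 0 ∧ R * Q = 0 ∧
      P + Q + R = 1 ∧ S = P + w • Q + (-1 - w) • R := by
  obtain ⟨Z, hZ⟩ : ∃ Z, Z = S * S := ⟨_, rfl⟩
  have e1 : S * S = Z := hZ.symm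
  have e2 : Z * S = 1 := by rw [hZ, hS]
  have e3 : S * Z = 1 := by rw [hZ, ← mul_assoc, hS]
  have e4 : Z * Z = S := by rw [hZ, ← mul_assoc, hS, one_mul]
  refine ⟨(1/3 : ℂ) • (1 + S + Z), (1/3 : ℂ) • (1 + (-1-w) • S + w • Z),
    (1/3 : ℂ) • (1 + w • S + (-1-w) • Z), ?_, ?_, ?_, ?_, ?_, ?_, ?_, ?_, ?_, ?_, ?_⟩ <;>
  · try simp only [mul_add, add_mul, smul_mul_assoc, mul_smul_comm, e1, e2, e3, e4, mul_one, one_mul]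
    match_scalars <;> grind

theorem aux_root : ∃ w : ℂ, w * w = -1 - w ∧ w.im ≠ 0 := by
  have h3 : √(3:ℝ) * √3 = 3 := Real.mul_self_sqrt (by norm_num)
  refine ⟨⟨-1/2, √3/2⟩, ?_, ?_⟩
  · apply Complex.ext
    · simp; nlinarith
    · simp; ring
  · simp

/-- Theorem 2.4 (existence of standard extensions), equivalence (a) ⇔ (b):
a braid representation `A, B` has a standard extension to `LB₃` with
`S = S₁S₂ = k·AB` and `Tr S = m` iff `(AB)³ = k⁻³·I`, `Tr(AB) = k⁻¹m` and `m ∈ ℤ`. -/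
theorem stmt_2 {V : Type*} [AddCommGroup V] [Module ℂ V] [FiniteDimensional ℂ V]
    (A B : Module.End ℂ V) (hA : IsUnit A) (hB : IsUnit B)
    (hbr : A * B * A = B * A * B) (k : ℂ) (hk : k ≠ 0) (m : ℂ) :
    (∃ S₁ S₂ : Module.End ℂ V, S₁ ^ 2 = 1 ∧ S₂ ^ 2 = 1 ∧
      S₁ * S₂ * S₁ = S₂ * S₁ * S₂ ∧
      S₁ * S₂ * A = B * (S₁ * S₂) ∧
      A * B * S₁ = S₂ * (A * B) ∧
      S₁ * S₂ = k • (A * B) ∧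
      LinearMap.trace ℂ V (S₁ * S₂) = m) ↔
    ((A * B) ^ 3 = (k ^ 3)⁻¹ • 1 ∧
      LinearMap.trace ℂ V (A * B) = k⁻¹ * m ∧ ∃ n : ℤ, m = (n : ℂ)) := by
  obtain ⟨w, hw, hwi⟩ := aux_root
  have hAB : ∀ x : Module.End ℂ V, x = k • (A * B) → A * B = k⁻¹ • x := by
    rintro _ rfl
    rw [smul_smul, inv_mul_cancel₀ hk, one_smul]
  constructor
  · rintro ⟨S, T, hS, hT, hST, -, -, hk1, hm⟩
    rw [sq] at hS hT
    have h2 : S * T * (S * T) = T * S := by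
      rw [mul_assoc, ← mul_assoc T, ← hST, ← mul_assoc, ← mul_assoc, hS, one_mul]
    have h3 : S * T * (S * T) * (S * T) = 1 := by
      rw [h2, mul_assoc, ← mul_assoc S, hS, one_mul, hT]
    have htr : LinearMap.trace ℂ V (S * T * (S * T)) = m := by
      rw [h2, LinearMap.trace_mul_comm, hm]
    have hAB' := hAB _ hk1
    refine ⟨?_, ?_, ?_⟩
    · rw [hAB', smul_pow, pow_succ (S * T), sq (S * T), h3, inv_pow]
    · rw [hAB', map_smul, hm, smul_eq_mul]
    · obtain ⟨P, Q, R, pp, qq, rr, pq, pr, qp, qr, rp, rq, h1, hdec⟩ := aux_proj _ h3 w hw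
      have hdec2 : S * T * (S * T) = P + (-1 - w) • Q + w • R := by
        rw [hdec]
        simp only [mul_add, add_mul, smul_mul_assoc, mul_smul_comm, pp, qq, rr, pq, pr, qp, qr,
          rp, rq]
        match_scalars <;> grind
      rw [hdec2] at htr
      rw [hdec] at hm
      simp only [map_add, map_smul, aux_idem _ pp, aux_idem _ qq, aux_idem _ rr,
        smul_eq_mul] at hm htr
      have hne : (1 + 2 * w) ≠ 0 := by
        intro h0
        have : (1 + 2 * w) * (1 + 2 * w) = -3 := by grind
        rw [h0] at this
        norm_num at this
      have hbc : (Module.finrank ℂ (LinearMap.range Q) : ℂ)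
          = Module.finrank ℂ (LinearMap.range R) := by
        apply mul_left_cancel₀ hne
        linear_combination hm - htr
      refine ⟨Module.finrank ℂ (LinearMap.range P) - Module.finrank ℂ (LinearMap.range Q), ?_⟩
      push_cast
      rw [← hm, ← hbc]
      ring
  · rintro ⟨h3, htr, n, hn⟩
    obtain ⟨S, hS⟩ : ∃ S, S = k • (A * B) := ⟨_, rfl⟩
    have hAB' := hAB _ hS
    have hS3 : S * S * S = 1 := by
      rw [← sq, ← pow_succ, hS, smul_pow, h3, smul_smul, mul_inv_cancel₀ (pow_ne_zero _ hk),
        one_smul]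
    have hm : LinearMap.trace ℂ V S = m := by
      rw [hS, map_smul, htr, smul_eq_mul, mul_inv_cancel_left₀ hk]
    obtain ⟨P, Q, R, pp, qq, rr, pq, pr, qp, qr, rp, rq, h1, hdec⟩ := aux_proj _ hS3 w hw
    have hbc : Module.finrank ℂ (LinearMap.range Q) = Module.finrank ℂ (LinearMap.range R) := by
      have hm' := hm
      rw [hdec, hn] at hm'
      simp only [map_add, map_smul, aux_idem _ pp, aux_idem _ qq, aux_idem _ rr,
        smul_eq_mul] at hm'
      have := congrArg Complex.im hm'
      simp at this
      have h5 : w.im * ((Module.finrank ℂ (LinearMap.range Q) : ℝ)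
          - Module.finrank ℂ (LinearMap.range R)) = 0 := by linear_combination this
      have h6 := (mul_eq_zero.mp h5).resolve_left hwi
      exact_mod_cast sub_eq_zero.mp h6
    obtain ⟨T, U, tq, rt, ur, qu, ut, tu⟩ := aux_swap Q R qq rr hbc
    have tp : T * P = 0 := by rw [← tq, mul_assoc, qp, mul_zero]
    have tr : T * R = 0 := by rw [← tq, mul_assoc, qr, mul_zero]
    have pt : P * T = 0 := by rw [← rt, ← mul_assoc, pr, zero_mul]
    have qt : Q * T = 0 := by rw [← rt, ← mul_assoc, qr, zero_mul]
    have up : U * P = 0 := by rw [← ur, mul_assoc, rp, mul_zero]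
    have uq : U * Q = 0 := by rw [← ur, mul_assoc, rq, mul_zero]
    have pu : P * U = 0 := by rw [← qu, ← mul_assoc, pq, zero_mul]
    have ru : R * U = 0 := by rw [← qu, ← mul_assoc, rq, zero_mul]
    have tt : T * T = 0 := by rw [← tq, mul_assoc, ← mul_assoc Q, qt, zero_mul, mul_zero]
    have uu : U * U = 0 := by rw [← ur, mul_assoc, ← mul_assoc R, ru, zero_mul, mul_zero]
    obtain ⟨X, hX⟩ : ∃ X, X = P + T + U := ⟨_, rfl⟩
    have hXX : X * X = 1 := by
      rw [hX, ← h1]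
      simp only [mul_add, add_mul, pp, tp, up, pt, tt, ut, pu, tu, uu]
      abel
    have hSXS : S * X * S = X := by
      rw [hX, hdec]
      simp only [mul_add, add_mul, smul_mul_assoc, mul_smul_comm, pp, qq, rr, pq, pr, qp, qr,
        rp, rq, tq, rt, ur, qu, ut, tu, tp, tr, pt, qt, up, uq, pu, ru, zero_mul, smul_zero]
      match_scalars <;> grind
    have hXS : X * (X * S) = S := by rw [← mul_assoc, hXX, one_mul]
    have hXSS : X * S * S = S * X := by
      conv_lhs => rw [← hSXS]
      rw [show S * X * S * S * S = S * X * (S * S * S) by simp only [mul_assoc], hS3, mul_one]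
    refine ⟨X, X * S, ?_, ?_, ?_, ?_, ?_, ?_, ?_⟩
    · rw [sq, hXX]
    · rw [sq, mul_assoc, ← mul_assoc S, hSXS, hXX]
    · rw [hXS, ← hXSS, mul_assoc (X * S), hXS]
    · rw [hXS, hS, smul_mul_assoc, mul_smul_comm, hbr, mul_assoc]
    · rw [hAB', smul_mul_assoc, mul_smul_comm, hXSS]
    · rw [hXS, hS]
    · rw [hXS, hm]
end

section
/- Let A, B be invertible complex 2×2 matrices with ABA = BAB and A ≠ B. Then (Tr(AB))² = det(AB). -/
lemma aux_aba (A B : Matrix (Fin 2) (Fin 2) ℂ) :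
    A * B * A = (A * B).trace • A + A.det • B - (B.trace * A.det) • (1 : Matrix (Fin 2) (Fin 2) ℂ) := by
  ext i j
  fin_cases i <;> fin_cases j <;>
    simp [Matrix.mul_apply, Fin.sum_univ_two, Matrix.trace_fin_two, Matrix.det_fin_two] <;> ring

/-- Lemma 3.4 (last statement): if invertible `2 × 2` matrices `A ≠ B` satisfy
the braid relation `ABA = BAB`, then `Tr(AB)² = det(AB)`. -/
theorem stmt_14 (A B : Matrix (Fin 2) (Fin 2) ℂ)
    (hA : IsUnit A) (hB : IsUnit B)
    (hbr : A * B * A = B * A * B)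
    (hAB : A ≠ B) :
    ((A * B).trace) ^ 2 = (A * B).det := by
  have hdA : A.det ≠ 0 := ((Matrix.isUnit_iff_isUnit_det A).1 hA).ne_zero
  have hdB : B.det ≠ 0 := ((Matrix.isUnit_iff_isUnit_det B).1 hB).ne_zero
  have hd : A.det = B.det := by
    have h := congrArg Matrix.det hbr
    simp only [Matrix.det_mul] at h
    exact mul_left_cancel₀ (mul_ne_zero hdA hdB) (by linear_combination h)
  have ht : A.trace = B.trace := by
    obtain ⟨u, hu⟩ := (hA.mul hB)
    have h1 : (u : Matrix (Fin 2) (Fin 2) ℂ) * A = B * u := by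
      rw [hu, hbr, Matrix.mul_assoc]
    have h2 : A = (↑u⁻¹ : Matrix (Fin 2) (Fin 2) ℂ) * (B * u) := by
      rw [← h1, Units.inv_mul_cancel_left]
    rw [h2, Matrix.trace_mul_comm, Units.mul_inv_cancel_right]
  have key : ((A * B).trace - A.det) • (A - B) = 0 := by
    have h := hbr
    rw [aux_aba A B, aux_aba B A, Matrix.trace_mul_comm B A, ← hd, ← ht] at h
    have h' := sub_left_injective h
    rw [← sub_eq_zero] at h'
    rw [← h']
    module
  have hs : (A * B).trace = A.det := by
    rcases smul_eq_zero.1 key with h | h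
    · exact sub_eq_zero.1 h
    · exact absurd (sub_eq_zero.1 h) hAB
  rw [hs, Matrix.det_mul, ← hd, sq]
end
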